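/- Let n ≥ 2 and n < p < +∞. If θ : [0, +∞) → [0, +∞) satisfies, for every u ∈ C_c^∞(ℝⁿ₊) and for all x, y ∈ ℝⁿ₊, the estimate |u(x) − u(y)| ≤ θ(d_ℍ(x,y)) · ( ∫_{ℝⁿ₊} ‖Du(z)‖^p zₙ^{p−n} dz )^{1/p}, then there exists a constant C > 0 such that for all t > 0, θ(t) ≥ C · min( t^{1 − n/p}, 1 ). -/

import Mathlib

open MeasureTheory Real Set
open scoped ENNReal

noncomputable section

/-- The last coordinate `xₙ` of a point of `ℝⁿ`. -/
def lastCoord (n : ℕ) (x : EuclideanSpace ℝ (Fin n)) : ℝ :=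
  if h : 0 < n then x ⟨n - 1, Nat.sub_lt h one_pos⟩ else 0

/-- The open upper half-space `ℝⁿ₊`. -/
def upperHalf (n : ℕ) : Set (EuclideanSpace ℝ (Fin n)) :=
  {z | 0 < lastCoord n z}

/-- The weighted energy `E_γ(u) = ∫_{ℝⁿ₊} ‖Du(z)‖^p zₙ^γ dz`, as a value in `[0, +∞]`. -/
def energy (n : ℕ) (γ p : ℝ) (u : EuclideanSpace ℝ (Fin n) → ℝ) : ℝ≥0∞ :=
  ∫⁻ z in upperHalf n, ENNReal.ofReal (‖fderiv ℝ u z‖ ^ p * lastCoord n z ^ γ)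

/-- The hyperbolic distance on the Poincaré half-space model. -/
def hypDist (n : ℕ) (x y : EuclideanSpace ℝ (Fin n)) : ℝ :=
  2 * Real.arsinh (‖x - y‖ / (2 * Real.sqrt (lastCoord n x * lastCoord n y)))

theorem lastCoord_eq {n : ℕ} (hn : 0 < n) (x : EuclideanSpace ℝ (Fin n)) :
    lastCoord n x = x ⟨n - 1, Nat.sub_lt hn one_pos⟩ := by
  simp [lastCoord, hn]

theorem exists_lastCoord_eq_one {n : ℕ} (hn : 0 < n) :
    ∃ e : EuclideanSpace ℝ (Fin n), ‖e‖ = 1 ∧ lastCoord n e = 1 :=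
  ⟨EuclideanSpace.single ⟨n - 1, Nat.sub_lt hn one_pos⟩ 1, by simp, by simp [lastCoord_eq hn]⟩

theorem abs_lastCoord_sub_le {n : ℕ} (hn : 0 < n) (x y : EuclideanSpace ℝ (Fin n)) :
    |lastCoord n x - lastCoord n y| ≤ ‖x - y‖ := by
  have := PiLp.norm_apply_le (x - y) ⟨n - 1, Nat.sub_lt hn one_pos⟩
  simpa [lastCoord_eq hn] using this

theorem lastCoord_smul {n : ℕ} (hn : 0 < n) (c : ℝ) (x : EuclideanSpace ℝ (Fin n)) :
    lastCoord n (c • x) = c * lastCoord n x := by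
  simp [lastCoord_eq hn]

theorem measurableSet_upperHalf {n : ℕ} (hn : 0 < n) : MeasurableSet (upperHalf n) := by
  have : Continuous (lastCoord n) := by
    have h : lastCoord n = fun x => x ⟨n - 1, Nat.sub_lt hn one_pos⟩ :=
      funext (lastCoord_eq hn)
    rw [h]
    fun_prop
  exact (isOpen_lt continuous_const this).measurableSet

/-- Dilating a unit vector with last coordinate one by `exp t` moves it by hyperbolic
distance `t`. -/
theorem hypDist_exp_smul {n : ℕ} (hn : 0 < n) {e : EuclideanSpace ℝ (Fin n)} (he : ‖e‖ = 1)
    (hl : lastCoord n e = 1) {t : ℝ} (ht : 0 ≤ t) : hypDist n e (Real.exp t • e) = t := by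
  have h1 : e - Real.exp t • e = (1 - Real.exp t) • e := by rw [sub_smul, one_smul]
  have h2 : Real.sqrt (Real.exp t) = Real.exp (t / 2) := by
    rw [Real.exp_half]
  have h3 : Real.exp t = Real.exp (t / 2) * Real.exp (t / 2) := by
    rw [← Real.exp_add]; congr 1; ring
  have h4 : |1 - Real.exp t| = Real.exp t - 1 := by
    rw [abs_sub_comm, abs_of_nonneg]
    linarith [Real.one_le_exp ht]
  have h5 : (Real.exp t - 1) / (2 * Real.exp (t / 2)) = Real.sinh (t / 2) := by
    rw [Real.sinh_eq, Real.exp_neg, h3]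
    have := Real.exp_pos (t / 2)
    field_simp
  rw [hypDist, h1, norm_smul, he, lastCoord_smul hn, hl, mul_one, mul_one, one_mul, h2,
    Real.norm_eq_abs, h4, h5, Real.arsinh_sinh]
  ring

/-- A function that is `K`-Lipschitz and supported in a ball of radius `s ≤ 1` around a point of
height one has energy at most `K ^ p * 2 ^ γ` times the volume of the ball. -/
theorem energy_le_of_lipschitz {n : ℕ} (hn : 0 < n) {γ p : ℝ} (hγ : 0 ≤ γ) (hp : 0 < p)
    {e : EuclideanSpace ℝ (Fin n)} (hl : lastCoord n e = 1) {s : ℝ} (hs : s ≤ 1)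
    {K : NNReal} {u : EuclideanSpace ℝ (Fin n) → ℝ} (hu : LipschitzWith K u)
    (hsupp : tsupport u ⊆ Metric.closedBall e s) :
    energy n γ p u ≤ ENNReal.ofReal ((K : ℝ) ^ p * 2 ^ γ) * volume (Metric.closedBall e s) := by
  have hpt : ∀ z ∈ upperHalf n, ENNReal.ofReal (‖fderiv ℝ u z‖ ^ p * lastCoord n z ^ γ) ≤
      (Metric.closedBall e s).indicator (fun _ => ENNReal.ofReal ((K : ℝ) ^ p * 2 ^ γ)) z := by
    intro z hz
    have hz0 : 0 < lastCoord n z := hz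
    by_cases hzs : z ∈ Metric.closedBall e s
    · rw [indicator_of_mem hzs]
      have hz2 : lastCoord n z ≤ 2 := by
        have h1 := (le_abs_self _).trans (abs_lastCoord_sub_le hn z e)
        have h2 : ‖z - e‖ ≤ s := mem_closedBall_iff_norm.mp hzs
        linarith
      have := norm_fderiv_le_of_lipschitz ℝ hu (x₀ := z)
      gcongr
    · rw [indicator_of_notMem hzs, fderiv_of_notMem_tsupport ℝ (fun hz' => hzs (hsupp hz')),
        norm_zero, Real.zero_rpow hp.ne']
      simp
  calc energy n γ p u
      ≤ ∫⁻ z in upperHalf n, (Metric.closedBall e s).indicator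
          (fun _ => ENNReal.ofReal ((K : ℝ) ^ p * 2 ^ γ)) z :=
        setLIntegral_mono' (measurableSet_upperHalf hn) hpt
    _ ≤ ∫⁻ z, (Metric.closedBall e s).indicator
          (fun _ => ENNReal.ofReal ((K : ℝ) ^ p * 2 ^ γ)) z := setLIntegral_le_lintegral _ _
    _ = _ := by rw [lintegral_indicator_const Metric.isClosed_closedBall.measurableSet]

/-- Rescaled bump functions concentrating at a point `e`, with Lipschitz constant of the order of
the inverse of the radius of the support. -/
theorem exists_bump_lipschitz (E : Type*) [NormedAddCommGroup E] [InnerProductSpace ℝ E]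
    [FiniteDimensional ℝ E] :
    ∃ K : NNReal, 0 < K ∧ ∀ (e : E) (r : NNReal), 0 < r → ∃ u : E → ℝ,
      ContDiff ℝ (⊤ : ℕ∞) u ∧ LipschitzWith (K / r) u ∧ u e = 1 ∧
      tsupport u ⊆ Metric.closedBall e (r / 2) := by
  let φ : ContDiffBump (0 : E) := ⟨1 / 4, 1 / 2, by norm_num, by norm_num⟩
  have hφ : ContDiff ℝ (⊤ : ℕ∞) φ := φ.contDiff
  obtain ⟨K, hK⟩ := hφ.lipschitzWith_of_hasCompactSupport φ.hasCompactSupport (by simp)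
  refine ⟨K + 1, by positivity, fun e r hr => ⟨fun z => φ ((r : ℝ)⁻¹ • (z - e)), ?_, ?_, ?_, ?_⟩⟩
  · exact hφ.comp (contDiff_const.smul (contDiff_id.sub contDiff_const))
  · refine LipschitzWith.of_dist_le_mul fun x y => ?_
    have hr' : (0 : ℝ) < r := hr
    calc dist (φ ((r : ℝ)⁻¹ • (x - e))) (φ ((r : ℝ)⁻¹ • (y - e)))
        ≤ K * dist ((r : ℝ)⁻¹ • (x - e)) ((r : ℝ)⁻¹ • (y - e)) := hK.dist_le_mul _ _
      _ = K * ((r : ℝ)⁻¹ * dist x y) := by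
        rw [dist_smul₀, dist_sub_right, Real.norm_of_nonneg (by positivity)]
      _ ≤ (K + 1) * ((r : ℝ)⁻¹ * dist x y) := by gcongr; simp
      _ = ((K + 1) / r : NNReal) * dist x y := by push_cast; ring
  · simpa using φ.one_of_mem_closedBall (x := 0) (by simp [φ])
  · refine closure_minimal (fun z hz => ?_) Metric.isClosed_closedBall
    have hr' : (0 : ℝ) < r := hr
    have h1 : (r : ℝ)⁻¹ • (z - e) ∈ Function.support φ := hz
    rw [φ.support_eq, mem_ball_zero_iff, norm_smul, Real.norm_of_nonneg (by positivity)] at h1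
    have h2 : (r : ℝ)⁻¹ * ‖z - e‖ < 1 / 2 := h1
    rw [inv_mul_lt_iff₀ hr'] at h2
    rw [mem_closedBall_iff_norm]
    linarith

/-- Optimality of the Morrey–Sobolev inequality on the hyperbolic space for compactly
supported functions. -/
theorem hyperbolic_morrey_sobolev_optimal_compact (n : ℕ) (hn : 2 ≤ n) (p : ℝ)
    (hnp : (n : ℝ) < p)
    (θ : ℝ → ℝ) (hθ : ∀ t, 0 ≤ t → 0 ≤ θ t)
    (h : ∀ u : EuclideanSpace ℝ (Fin n) → ℝ,
      ContDiff ℝ (⊤ : ℕ∞) u → HasCompactSupport u → tsupport u ⊆ upperHalf n →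
      ∀ x ∈ upperHalf n, ∀ y ∈ upperHalf n,
        |u x - u y| ≤ θ (hypDist n x y) * (energy n (p - n) p u).toReal ^ (1 / p)) :
    ∃ C : ℝ, 0 < C ∧
      ∀ t > (0 : ℝ), C * min (t ^ (1 - (n : ℝ) / p)) 1 ≤ θ t := by
  have hn0 : 0 < n := by omega
  have hn1 : (0 : ℝ) < n := by exact_mod_cast hn0
  have hp : 0 < p := hn1.trans hnp
  obtain ⟨e, he, hl⟩ := exists_lastCoord_eq_one hn0
  obtain ⟨K, hK, hbump⟩ := exists_bump_lipschitz (EuclideanSpace ℝ (Fin n))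
  set V : ℝ := (volume (Metric.ball (0 : EuclideanSpace ℝ (Fin n)) 1)).toReal with hV
  have hVtop : volume (Metric.ball (0 : EuclideanSpace ℝ (Fin n)) 1) ≠ ∞ :=
    measure_ball_lt_top.ne
  have hVpos : 0 < V :=
    ENNReal.toReal_pos (Metric.measure_ball_pos volume _ one_pos).ne' hVtop
  have hK' : (0 : ℝ) < K := hK
  set A : ℝ := (K : ℝ) ^ p * 2 ^ (p - n) * V with hA
  have hApos : 0 < A := by positivity
  refine ⟨(A ^ (1 / p))⁻¹, by positivity, fun t ht => ?_⟩
  obtain ⟨r, hr⟩ : ∃ r : NNReal, (r : ℝ) = min t 1 := ⟨⟨min t 1, by positivity⟩, rfl⟩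
  have hr0 : (0 : ℝ) < r := by rw [hr]; positivity
  have hr1 : (r : ℝ) ≤ 1 := hr ▸ min_le_right _ _
  have hrt : (r : ℝ) ≤ t := hr ▸ min_le_left _ _
  obtain ⟨u, hu, huL, hue, hus⟩ := hbump e r hr0
  have hsub : tsupport u ⊆ upperHalf n := fun z hz => by
    have h1 := (neg_le_abs _).trans (abs_lastCoord_sub_le hn0 z e)
    have h2 := mem_closedBall_iff_norm.mp (hus hz)
    change 0 < lastCoord n z
    linarith
  have hcs : HasCompactSupport u :=
    (isCompact_closedBall e _).of_isClosed_subset (isClosed_tsupport u) hus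
  have huy : u (Real.exp t • e) = 0 := by
    refine image_eq_zero_of_notMem_tsupport fun hy => ?_
    have h2 := mem_closedBall_iff_norm.mp (hus hy)
    have h3 : Real.exp t • e - e = (Real.exp t - 1) • e := by rw [sub_smul, one_smul]
    rw [h3, norm_smul, he, mul_one, Real.norm_eq_abs] at h2
    linarith [le_abs_self (Real.exp t - 1), Real.add_one_le_exp t]
  have hE : (energy n (p - n) p u).toReal ≤ A * (r : ℝ) ^ ((n : ℝ) - p) := by
    refine ENNReal.toReal_le_of_le_ofReal (by positivity) ?_
    refine (energy_le_of_lipschitz hn0 (by linarith) hp hl (s := r) hr1 huL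
      (hus.trans (Metric.closedBall_subset_closedBall (by linarith)))).trans_eq ?_
    rw [Measure.addHaar_closedBall _ _ hr0.le, finrank_euclideanSpace_fin,
      ← ENNReal.ofReal_toReal hVtop, ← ENNReal.ofReal_mul (by positivity),
      ← ENNReal.ofReal_mul (by positivity)]
    congr 1
    rw [NNReal.coe_div, Real.div_rpow hK'.le hr0.le, Real.rpow_sub hr0 (n : ℝ) p,
      Real.rpow_natCast, ← hV, hA]
    ring
  have key := h u hu hcs hsub e (by simp [upperHalf, hl]) (Real.exp t • e)
    (by simp [upperHalf, lastCoord_smul hn0, hl, Real.exp_pos])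
  rw [hypDist_exp_smul hn0 he hl ht.le, hue, huy, sub_zero, abs_one] at key
  have hmin : min (t ^ (1 - (n : ℝ) / p)) 1 = (r : ℝ) ^ (1 - (n : ℝ) / p) := by
    have hα : 0 ≤ 1 - (n : ℝ) / p := by
      rw [sub_nonneg, div_le_one hp]; exact hnp.le
    rw [hr]
    rcases le_total t 1 with h1 | h1
    · rw [min_eq_left h1, min_eq_left (Real.rpow_le_one ht.le h1 hα)]
    · rw [min_eq_right h1, min_eq_right (Real.one_le_rpow h1 hα), Real.one_rpow]
  have hpow : (energy n (p - n) p u).toReal ^ (1 / p) ≤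
      A ^ (1 / p) * ((r : ℝ) ^ (1 - (n : ℝ) / p))⁻¹ := by
    calc (energy n (p - n) p u).toReal ^ (1 / p)
        ≤ (A * (r : ℝ) ^ ((n : ℝ) - p)) ^ (1 / p) := by gcongr
      _ = _ := by
        rw [Real.mul_rpow hApos.le (by positivity), ← Real.rpow_mul hr0.le,
          ← Real.rpow_neg hr0.le]
        congr 2
        field_simp
        ring
  have hfin := key.trans (mul_le_mul_of_nonneg_left hpow (hθ t ht.le))
  have ha : 0 < A ^ (1 / p) := by positivity
  have hb : 0 < (r : ℝ) ^ (1 - (n : ℝ) / p) := by positivity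
  rw [hmin, inv_mul_le_iff₀ ha]
  rw [← mul_assoc, ← div_eq_mul_inv, le_div_iff₀ hb, one_mul] at hfin
  linarith
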